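/- Let p_X be the Gaussian distribution N(μ_X, σ_X²) with σ_X > 0, and let R, R_c ∈ [0,∞], P ∈ [0,∞). Then the distortion-rate-perception function with Kullback–Leibler perception measure satisfies the upper bound D(R,R_c,P|φ_KL) ≤ σ_X² − σ_X² ξ(R,R_c)² + (max{σ(P) − σ_X ξ(R,R_c), 0})². -/

import Mathlib

open MeasureTheory ProbabilityTheory Real Set
open scoped ENNReal NNReal

noncomputable section

open Classical in
/-- Kullback-Leibler divergence of `q` from `p`, in `[0,∞]`. -/
def KLD {α : Type*} [MeasurableSpace α] (q p : Measure α) : ℝ≥0∞ :=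
  if q ≪ p ∧ Integrable (fun x => Real.log (q.rnDeriv p x).toReal) q
  then ENNReal.ofReal (∫ x, Real.log (q.rnDeriv p x).toReal ∂q) else ⊤

/-- Mutual information between `f` and `g` under `μ`. -/
def mutInfo {Ω α β : Type*} [MeasurableSpace Ω] [MeasurableSpace α] [MeasurableSpace β]
    (μ : Measure Ω) (f : Ω → α) (g : Ω → β) : ℝ≥0∞ :=
  KLD (μ.map (fun ω => (f ω, g ω))) ((μ.map f).prod (μ.map g))

/-- Squared Wasserstein-2 distance. -/
def W2sq (p q : Measure ℝ) : ℝ≥0∞ :=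
  ⨅ (cpl : Measure (ℝ × ℝ)) (_ : IsProbabilityMeasure cpl) (_ : cpl.map Prod.fst = p)
    (_ : cpl.map Prod.snd = q), ∫⁻ xy, ENNReal.ofReal ((xy.1 - xy.2) ^ 2) ∂cpl

/-- `exp(-x)` for `x ∈ [0,∞]`, with `exp(-∞) = 0`. -/
def expNeg (x : ℝ≥0∞) : ℝ := if x = ⊤ then 0 else Real.exp (-x.toReal)

/-- Feasibility predicate for the distortion-rate-perception function. -/
def DRPfeasible (pX : Measure ℝ) (φ : Measure ℝ → Measure ℝ → ℝ≥0∞) (R Rc P : ℝ≥0∞)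
    (μ : Measure (ℝ × ℝ × ℝ)) : Prop :=
  ∃ hμ : IsProbabilityMeasure μ,
    μ.map (fun w => w.1) = pX ∧
    (haveI := hμ
     CondIndepFun (MeasurableSpace.comap (fun w : ℝ × ℝ × ℝ => w.2.1) inferInstance)
      ((measurable_fst.comp measurable_snd).comap_le)
      (fun w : ℝ × ℝ × ℝ => w.1) (fun w : ℝ × ℝ × ℝ => w.2.2) μ) ∧
    mutInfo μ (fun w => w.1) (fun w => w.2.1) ≤ R ∧
    mutInfo μ (fun w => w.2.2) (fun w => w.2.1) ≤ R + Rc ∧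
    φ pX (μ.map (fun w => w.2.2)) ≤ P

/-- Mean squared distortion of a joint law of `(X, U, X̂)`. -/
def distortion (μ : Measure (ℝ × ℝ × ℝ)) : ℝ≥0∞ :=
  ∫⁻ w, ENNReal.ofReal ((w.1 - w.2.2) ^ 2) ∂μ

/-- The distortion-rate-perception function `D(R, R_c, P | φ)`. -/
def DRP (pX : Measure ℝ) (φ : Measure ℝ → Measure ℝ → ℝ≥0∞) (R Rc P : ℝ≥0∞) : ℝ≥0∞ :=
  ⨅ (μ : Measure (ℝ × ℝ × ℝ)) (_ : DRPfeasible pX φ R Rc P μ), distortion μ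

/-- `D(R, R_c, ∞)`: the DRP function without perception constraint. -/
def DRPinf (pX : Measure ℝ) (R Rc : ℝ≥0∞) : ℝ≥0∞ :=
  DRP pX (fun _ _ => 0) R Rc ⊤

/-- Deterministic-decoder (entropy-constrained quantization) function `D_e(R, R_c)`,
with `H(X̂) := I(X̂; X̂)`. -/
def De (pX : Measure ℝ) (R Rc : ℝ≥0∞) : ℝ≥0∞ :=
  ⨅ (cpl : Measure (ℝ × ℝ)) (_ : IsProbabilityMeasure cpl ∧ cpl.map Prod.fst = pX ∧
      mutInfo cpl Prod.fst Prod.snd ≤ R ∧ mutInfo cpl Prod.snd Prod.snd ≤ R + Rc),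
    ∫⁻ w, ENNReal.ofReal ((w.1 - w.2) ^ 2) ∂cpl

/-- The Gaussian measure `N(μ, σ²)`. -/
def gauss (μ σ : ℝ) : Measure ℝ := gaussianReal μ ⟨σ ^ 2, sq_nonneg σ⟩

end
noncomputable section

/-- `ξ(R, R_c) = √((1 - e^{-2R})(1 - e^{-2(R+R_c)}))`. -/
def xiRRc (R Rc : ℝ≥0∞) : ℝ :=
  Real.sqrt ((1 - expNeg (2 * R)) * (1 - expNeg (2 * (R + Rc))))

/-- `ψ(σ) = log(σ_X/σ) + (σ² - σ_X²)/(2σ_X²)`. -/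
def psi (σX s : ℝ) : ℝ := Real.log (σX / s) + (s ^ 2 - σX ^ 2) / (2 * σX ^ 2)

/-- `δ₊(σ̂, α)` from the improved lower bound. -/
def deltaPlus (σX : ℝ) (R Rc : ℝ≥0∞) (P s α : ℝ) : ℝ :=
  max (σX * expNeg (R + Rc) -
    Real.sqrt (σX ^ 2 - α * (σX ^ 2 + s ^ 2 - P) + α ^ 2 * s ^ 2)) 0 / α

/-- The inner `sup` over `α > 0` in the improved lower bound `D̲'`. -/
def DlowerPrimeFun (σX : ℝ) (R Rc : ℝ≥0∞) (P s : ℝ) : ℝ :=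
  sSup ((fun α => σX ^ 2 + s ^ 2 - 2 * σX *
    Real.sqrt ((1 - expNeg (2 * R)) * (s ^ 2 - deltaPlus σX R Rc P s α ^ 2))) '' Set.Ioi 0)

/-- The improved explicit lower bound `D̲'(R, R_c, P | W₂²)`. -/
def DlowerPrime (σX : ℝ) (R Rc : ℝ≥0∞) (P : ℝ) : ℝ :=
  sInf (DlowerPrimeFun σX R Rc P '' Set.Icc (max (σX - Real.sqrt P) 0) σX)

/-- The explicit lower bound `D̲(R, R_c, P | W₂²)` of Xie et al. -/
def DlowerW2 (σX : ℝ) (R Rc : ℝ≥0∞) (P : ℝ) : ℝ :=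
  sInf ((fun s => σX ^ 2 + s ^ 2 - 2 * σX *
      Real.sqrt ((1 - expNeg (2 * R)) *
        (s ^ 2 - max (σX * expNeg (R + Rc) - Real.sqrt P) 0 ^ 2)))
    '' Set.Icc (max (σX - Real.sqrt P) 0) σX)

end


/-- Standard Gaussian. -/
noncomputable abbrev stdg : Measure ℝ := gaussianReal 0 1

lemma KLD_withDensity_exp {α : Type*} [MeasurableSpace α] (p q : Measure α) [SigmaFinite p]
    (h : α → ℝ) (hm : Measurable h)
    (hq : q = p.withDensity (fun x => ENNReal.ofReal (Real.exp (h x))))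
    (hint : Integrable h q) :
    KLD q p = ENNReal.ofReal (∫ x, h x ∂q) := by
  have hac : q ≪ p := by rw [hq]; exact withDensity_absolutelyContinuous _ _
  have hrn : q.rnDeriv p =ᵐ[p] (fun x => ENNReal.ofReal (Real.exp (h x))) := by
    rw [hq]; exact Measure.rnDeriv_withDensity _ (by fun_prop)
  have hlog : (fun x => Real.log (q.rnDeriv p x).toReal) =ᵐ[q] h := by
    filter_upwards [hac.ae_le hrn] with x hx
    rw [hx, ENNReal.toReal_ofReal (Real.exp_pos _).le, Real.log_exp]
  unfold KLD
  rw [if_pos ⟨hac, hint.congr hlog.symm⟩, integral_congr_ae hlog]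

lemma gauss_eq (m t : ℝ) : gauss m t = gaussianReal m (Real.toNNReal (t ^ 2)) := by
  unfold gauss
  congr 1
  exact (Real.toNNReal_of_nonneg (sq_nonneg t)).symm

lemma gauss_withDensity (m m' σ τ : ℝ) (hσ : 0 < σ) (hτ : 0 < τ) :
    gauss m' τ = (gauss m σ).withDensity (fun x => ENNReal.ofReal (Real.exp
      (Real.log (σ / τ) - (x - m') ^ 2 / (2 * τ ^ 2) + (x - m) ^ 2 / (2 * σ ^ 2)))) := by
  rw [gauss_eq, gauss_eq]
  have h1 : Real.toNNReal (σ ^ 2) ≠ 0 := by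
    rw [Ne, Real.toNNReal_eq_zero, not_le]; positivity
  have h2 : Real.toNNReal (τ ^ 2) ≠ 0 := by
    rw [Ne, Real.toNNReal_eq_zero, not_le]; positivity
  rw [gaussianReal_of_var_ne_zero _ h1, gaussianReal_of_var_ne_zero _ h2,
    ← withDensity_mul _ (measurable_gaussianPDF _ _) (by fun_prop)]
  congr 1
  ext x
  simp only [Pi.mul_apply, gaussianPDF_def]
  rw [← ENNReal.ofReal_mul (gaussianPDFReal_nonneg _ _ _)]
  congr 1
  simp only [gaussianPDFReal_def, Real.coe_toNNReal _ (sq_nonneg _)]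
  rw [Real.exp_add, Real.exp_sub, Real.exp_log (by positivity),
    Real.sqrt_mul (x := 2 * π) (by positivity) (τ ^ 2), Real.sqrt_mul (x := 2 * π) (by positivity) (σ ^ 2), Real.sqrt_sq hσ.le,
    Real.sqrt_sq hτ.le, neg_div, neg_div, Real.exp_neg, Real.exp_neg]
  have : √(2 * π) ≠ 0 := by positivity
  field_simp

lemma stdg_map_affine (m t : ℝ) : stdg.map (fun z => m + t * z) = gauss m t := by
  have : (fun z : ℝ => m + t * z) = (fun z => m + z) ∘ (fun z => t * z) := rfl
  rw [this, ← Measure.map_map (by fun_prop) (by fun_prop), gaussianReal_map_const_mul,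
    gaussianReal_map_const_add, mul_zero, zero_add, mul_one]
  rfl

instance (m t : ℝ) : IsProbabilityMeasure (gauss m t) := by rw [gauss_eq]; infer_instance

lemma stdg_prod_map (m t a c : ℝ) (hac : a ^ 2 + c ^ 2 = 1) :
    (stdg.prod stdg).map (fun w => m + t * (a * w.1 + c * w.2)) = gauss m t := by
  have h : (fun w : ℝ × ℝ => m + t * (a * w.1 + c * w.2)) =
      (fun w : ℝ × ℝ => w.1 + w.2) ∘ (Prod.map (fun z => m + (t * a) * z) (fun z => 0 + (t * c) * z)) := by
    ext w; simp; ring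
  rw [h, ← Measure.map_map (by fun_prop) (by fun_prop), ← Measure.map_prod_map _ _ (by fun_prop) (by fun_prop),
    stdg_map_affine, stdg_map_affine]
  have := gaussianReal_conv_gaussianReal (m₁ := m) (m₂ := 0) (v₁ := Real.toNNReal ((t*a) ^ 2))
    (v₂ := Real.toNNReal ((t*c) ^ 2))
  rw [Measure.conv] at this
  rw [gauss_eq, gauss_eq, gauss_eq, this, add_zero]
  congr 1
  apply NNReal.eq
  simp only [NNReal.coe_add, Real.coe_toNNReal _ (sq_nonneg _)]
  linear_combination t ^ 2 * hac

lemma stdg_int_sq : ∫ x, x ^ 2 ∂stdg = 1 := by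
  have := variance_fun_id_gaussianReal (μ := 0) (v := 1)
  rw [variance_eq_integral measurable_id'.aemeasurable] at this
  simpa [integral_id_gaussianReal] using this

lemma stdg_integrable_sq : Integrable (fun x : ℝ => x ^ 2) stdg := by
  have := (memLp_id_gaussianReal (μ := 0) (v := 1) 2).integrable_sq
  simpa using this

lemma stdg_integrable_id : Integrable (fun x : ℝ => x) stdg :=
  memLp_one_iff_integrable.1 (memLp_id_gaussianReal (μ := 0) (v := 1) 1)

lemma stdg_int_id : ∫ x, x ∂stdg = 0 := integral_id_gaussianReal

/-- Quadratic form against standard Gaussian pair. -/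
lemma stdg_quad (k A B C : ℝ) :
    Integrable (fun w : ℝ × ℝ => k + (A * w.1 ^ 2 + (B * (w.1 * w.2) + C * w.2 ^ 2))) (stdg.prod stdg) ∧
    ∫ w, (k + (A * w.1 ^ 2 + (B * (w.1 * w.2) + C * w.2 ^ 2))) ∂(stdg.prod stdg) = k + A + C := by
  have i1 : Integrable (fun w : ℝ × ℝ => w.1 ^ 2) (stdg.prod stdg) := stdg_integrable_sq.comp_fst _
  have i2 : Integrable (fun w : ℝ × ℝ => w.2 ^ 2) (stdg.prod stdg) := stdg_integrable_sq.comp_snd _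
  have i3 : Integrable (fun w : ℝ × ℝ => w.1 * w.2) (stdg.prod stdg) :=
    stdg_integrable_id.mul_prod stdg_integrable_id
  have e1 : ∫ w : ℝ × ℝ, w.1 ^ 2 ∂(stdg.prod stdg) = 1 := by
    have := integral_fun_fst (μ := stdg) (ν := stdg) (fun x : ℝ => x ^ 2)
    simpa [stdg_int_sq] using this
  have e2 : ∫ w : ℝ × ℝ, w.2 ^ 2 ∂(stdg.prod stdg) = 1 := by
    have := integral_fun_snd (μ := stdg) (ν := stdg) (fun x : ℝ => x ^ 2)
    simpa [stdg_int_sq] using this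
  have e3 : ∫ w : ℝ × ℝ, w.1 * w.2 ∂(stdg.prod stdg) = 0 := by
    have := integral_prod_mul (μ := stdg) (ν := stdg) (fun x : ℝ => x) (fun x : ℝ => x)
    simpa [stdg_int_id] using this
  have j := (i1.const_mul A).add ((i3.const_mul B).add (i2.const_mul C))
  refine ⟨(integrable_const k).add j, ?_⟩
  have r1 := integral_add (integrable_const (μ := stdg.prod stdg) k) j
  have r2 := integral_add (i1.const_mul A) ((i3.const_mul B).add (i2.const_mul C))
  have r3 := integral_add (i3.const_mul B) (i2.const_mul C)
  simp only [Pi.add_apply] at r1 r2 r3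
  rw [r1, r2, r3, integral_const_mul, integral_const_mul, integral_const_mul, e1, e2, e3]
  simp; ring

/-- Joint law and mutual information. -/
lemma KLD_joint (m t a c : ℝ) (ht : 0 < t) (hc : 0 < c) (hac : a ^ 2 + c ^ 2 = 1) :
    KLD ((stdg.prod stdg).map (fun w => (m + t * (a * w.1 + c * w.2), w.1)))
      ((gauss m t).prod stdg) = ENNReal.ofReal (-Real.log c) := by
  set h : ℝ × ℝ → ℝ := fun y => Real.log (t / (t * c)) - (y.1 - (m + t * a * y.2)) ^ 2 / (2 * (t * c) ^ 2) +
    (y.1 - m) ^ 2 / (2 * t ^ 2) with hh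
  have hhm : Measurable h := by fun_prop
  have hcomp : ∀ w : ℝ × ℝ, h (m + t * (a * w.1 + c * w.2), w.1) =
      -Real.log c + ((a ^ 2 / 2) * w.1 ^ 2 + ((a * c) * (w.1 * w.2) + (c ^ 2 / 2 - 1 / 2) * w.2 ^ 2)) := by
    intro w
    have : t / (t * c) = c⁻¹ := by field_simp
    simp only [hh, this, Real.log_inv]
    field_simp
    ring
  have hT : Measurable (fun w : ℝ × ℝ => (m + t * (a * w.1 + c * w.2), w.1)) := by fun_prop
  have hq := stdg_quad (-Real.log c) (a ^ 2 / 2) (a * c) (c ^ 2 / 2 - 1 / 2)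
  have hint : Integrable h ((stdg.prod stdg).map (fun w => (m + t * (a * w.1 + c * w.2), w.1))) := by
    rw [integrable_map_measure hhm.aestronglyMeasurable hT.aemeasurable]
    refine hq.1.congr (Filter.Eventually.of_forall fun w => ?_)
    exact (hcomp w).symm
  rw [KLD_withDensity_exp _ _ h hhm ?_ hint]
  · rw [integral_map hT.aemeasurable hhm.aestronglyMeasurable]
    simp_rw [hcomp]
    rw [hq.2]
    congr 1
    linear_combination hac / 2
  · refine Measure.ext_of_lintegral _ fun f hf => ?_
    rw [lintegral_map hf hT, lintegral_prod _ (by fun_prop),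
      lintegral_withDensity_eq_lintegral_mul _ (by fun_prop) hf,
      lintegral_prod_symm _ (by fun_prop)]
    refine lintegral_congr fun u => ?_
    have h1 := stdg_map_affine (m + t * a * u) (t * c)
    rw [gauss_withDensity m (m + t * a * u) t (t * c) ht (by positivity)] at h1
    have h2 : ∫⁻ z, f (m + t * (a * u + c * z), u) ∂stdg =
        ∫⁻ y, f (y, u) ∂(stdg.map (fun z => m + t * a * u + t * c * z)) := by
      rw [lintegral_map (by fun_prop) (by fun_prop)]
      refine lintegral_congr fun z => ?_
      congr 2; ring
    simp only
    rw [h2, h1, lintegral_withDensity_eq_lintegral_mul _ (by fun_prop) (by fun_prop)]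
    rfl

lemma KLD_gauss (m s σ : ℝ) (hs : 0 < s) (hσ : 0 < σ) :
    KLD (gauss m s) (gauss m σ) = ENNReal.ofReal
      (Real.log (σ / s) + (s ^ 2 - σ ^ 2) / (2 * σ ^ 2)) := by
  set h : ℝ → ℝ := fun x => Real.log (σ / s) - (x - m) ^ 2 / (2 * s ^ 2) + (x - m) ^ 2 / (2 * σ ^ 2) with hh
  have hhm : Measurable h := by fun_prop
  have hcomp : ∀ z, h (m + s * z) = Real.log (σ / s) + (s ^ 2 / (2 * σ ^ 2) - 1 / 2) * z ^ 2 := by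
    intro z
    simp only [hh]
    field_simp
    ring
  have hi : Integrable h (gauss m s) := by
    rw [← stdg_map_affine, integrable_map_measure hhm.aestronglyMeasurable (by fun_prop)]
    refine Integrable.congr ((integrable_const _).add (stdg_integrable_sq.const_mul _))
      (Filter.Eventually.of_forall fun z => (hcomp z).symm)
  rw [KLD_withDensity_exp _ _ h hhm (gauss_withDensity m m σ s hσ hs) hi]
  rw [← stdg_map_affine, integral_map (by fun_prop) hhm.aestronglyMeasurable]
  simp_rw [hcomp]
  rw [integral_add (integrable_const _) (stdg_integrable_sq.const_mul _), integral_const_mul, stdg_int_sq]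
  simp
  congr 1
  field_simp

lemma stdg_lint (K α β : ℝ) (hK : 0 ≤ K) :
    ∫⁻ x, ENNReal.ofReal (K + (α * x + β) ^ 2) ∂stdg = ENNReal.ofReal (K + α ^ 2 + β ^ 2) := by
  have i : Integrable (fun x : ℝ => (K + β ^ 2) + (α ^ 2 * x ^ 2 + 2 * α * β * x)) stdg :=
    (integrable_const _).add ((stdg_integrable_sq.const_mul _).add (stdg_integrable_id.const_mul _))
  have e : (fun x : ℝ => K + (α * x + β) ^ 2) =
      (fun x : ℝ => (K + β ^ 2) + (α ^ 2 * x ^ 2 + 2 * α * β * x)) := by ext x; ring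
  rw [← ofReal_integral_eq_lintegral_ofReal (by rw [e]; exact i)
    (Filter.Eventually.of_forall fun x => by simp only [Pi.zero_apply]; positivity)]
  have j : Integrable (fun x : ℝ => α ^ 2 * x ^ 2 + 2 * α * β * x) stdg :=
    (stdg_integrable_sq.const_mul _).add (stdg_integrable_id.const_mul _)
  rw [e, integral_add (integrable_const _) j,
    integral_add (stdg_integrable_sq.const_mul _) (stdg_integrable_id.const_mul _),
    integral_const_mul, integral_const_mul, stdg_int_sq, stdg_int_id]
  simp
  congr 1; ring

lemma stdg_lint3 (A B C : ℝ) :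
    ∫⁻ w : ℝ × ℝ × ℝ, ENNReal.ofReal ((A * w.1 + B * w.2.1 + C * w.2.2) ^ 2) ∂(stdg.prod (stdg.prod stdg))
      = ENNReal.ofReal (A ^ 2 + B ^ 2 + C ^ 2) := by
  rw [lintegral_prod _ (by fun_prop)]
  have : ∀ u : ℝ, ∫⁻ z : ℝ × ℝ, ENNReal.ofReal ((A * u + B * z.1 + C * z.2) ^ 2) ∂(stdg.prod stdg) =
      ENNReal.ofReal (C ^ 2 + B ^ 2 + (A * u + 0) ^ 2) := by
    intro u
    rw [lintegral_prod _ (by fun_prop)]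
    have : ∀ z : ℝ, ∫⁻ y : ℝ, ENNReal.ofReal ((A * u + B * z + C * y) ^ 2) ∂stdg =
        ENNReal.ofReal (C ^ 2 + (B * z + A * u) ^ 2) := by
      intro z
      have := stdg_lint 0 C (A * u + B * z) le_rfl
      convert this using 1
      · refine lintegral_congr fun y => ?_
        congr 1; ring
      · congr 1; ring
    simp_rw [this]
    rw [stdg_lint _ _ _ (sq_nonneg C), add_zero]
  simp_rw [this]
  rw [stdg_lint _ _ _ (by positivity)]
  congr 1; ring

lemma condIndep_aux (F G : ℝ → ℝ → ℝ) (hF : Measurable (Function.uncurry F))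
    (hG : Measurable (Function.uncurry G)) (μ : Measure (ℝ × ℝ × ℝ)) [IsProbabilityMeasure μ]
    (hμ : μ = (stdg.prod (stdg.prod stdg)).map (fun w => (F w.1 w.2.1, w.1, G w.1 w.2.2))) :
    CondIndepFun (MeasurableSpace.comap (fun w : ℝ × ℝ × ℝ => w.2.1) inferInstance)
      ((measurable_fst.comp measurable_snd).comap_le)
      (fun w : ℝ × ℝ × ℝ => w.1) (fun w : ℝ × ℝ × ℝ => w.2.2) μ := by
  have hT : Measurable (fun w : ℝ × ℝ × ℝ => (F w.1 w.2.1, w.1, G w.1 w.2.2)) := by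
    refine Measurable.prodMk (hF.comp (f := fun w : ℝ × ℝ × ℝ => (w.1, w.2.1)) (by fun_prop))
      (Measurable.prodMk (by fun_prop) (hG.comp (f := fun w : ℝ × ℝ × ℝ => (w.1, w.2.2)) (by fun_prop)))
  have key : ∀ f : ℝ × ℝ × ℝ → ℝ≥0∞, Measurable f → ∫⁻ w, f w ∂μ =
      ∫⁻ u, ∫⁻ z, ∫⁻ y, f (F u z, u, G u y) ∂stdg ∂stdg ∂stdg := by
    intro f hf
    rw [hμ, lintegral_map hf hT, lintegral_prod _ (show Measurable
      (fun w : ℝ × ℝ × ℝ => f (F w.1 w.2.1, w.1, G w.1 w.2.2)) from hf.comp hT).aemeasurable]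
    refine lintegral_congr fun u => ?_
    rw [lintegral_prod _ (show Measurable
      (fun w : ℝ × ℝ => f (F u w.1, u, G u w.2)) from
        (hf.comp hT).comp (measurable_prodMk_left (x := u))).aemeasurable]
  let κ₁ : Kernel ℝ ℝ := (Kernel.id ×ₖ Kernel.const ℝ stdg).map (Function.uncurry F)
  let κ₂ : Kernel ℝ ℝ := (Kernel.id ×ₖ Kernel.const ℝ stdg).map (Function.uncurry G)
  have : IsMarkovKernel κ₁ := Kernel.IsMarkovKernel.map _ hF
  have : IsMarkovKernel κ₂ := Kernel.IsMarkovKernel.map _ hG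
  have l₁ : ∀ (u : ℝ) (f : ℝ → ℝ≥0∞), Measurable f → ∫⁻ x, f x ∂κ₁ u = ∫⁻ z, f (F u z) ∂stdg := by
    intro u f hf
    simp only [κ₁]
    rw [Kernel.lintegral_map _ hF _ hf, Kernel.lintegral_id_prod (by fun_prop)]
    simp [Function.uncurry]
  have l₂ : ∀ (u : ℝ) (f : ℝ → ℝ≥0∞), Measurable f → ∫⁻ x, f x ∂κ₂ u = ∫⁻ z, f (G u z) ∂stdg := by
    intro u f hf
    simp only [κ₂]
    rw [Kernel.lintegral_map _ hG _ hf, Kernel.lintegral_id_prod (by fun_prop)]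
    simp [Function.uncurry]
  have hk : Measurable (fun w : ℝ × ℝ × ℝ => w.2.1) := by fun_prop
  have hmk : μ.map (fun w => w.2.1) = stdg := by
    refine Measure.ext_of_lintegral _ fun f hf => ?_
    rw [lintegral_map hf hk, key _ (by fun_prop)]
    simp
  have c₁ : condDistrib (fun w : ℝ × ℝ × ℝ => w.1) (fun w => w.2.1) μ =ᵐ[μ.map (fun w => w.2.1)] κ₁ := by
    refine condDistrib_ae_eq_of_measure_eq_compProd _ (by fun_prop) ?_
    rw [hmk]
    refine Measure.ext_of_lintegral _ fun f hf => ?_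
    rw [lintegral_map hf (by fun_prop), key _ (by fun_prop), Measure.lintegral_compProd hf]
    refine lintegral_congr fun u => ?_
    rw [l₁ u _ (by fun_prop)]
    simp
  have c₂ : condDistrib (fun w : ℝ × ℝ × ℝ => w.2.2) (fun w => w.2.1) μ =ᵐ[μ.map (fun w => w.2.1)] κ₂ := by
    refine condDistrib_ae_eq_of_measure_eq_compProd _ (by fun_prop) ?_
    rw [hmk]
    refine Measure.ext_of_lintegral _ fun f hf => ?_
    rw [lintegral_map hf (by fun_prop), key _ (by fun_prop), Measure.lintegral_compProd hf]
    refine lintegral_congr fun u => ?_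
    rw [l₂ u _ (by fun_prop)]
    simp
  refine (condIndepFun_iff_map_prod_eq_prod_condDistrib_prod_condDistrib (by fun_prop) (by fun_prop) hk).2 ?_
  refine Measure.ext_of_lintegral _ fun f hf => ?_
  rw [lintegral_map hf (by fun_prop), key _ (by fun_prop), Measure.lintegral_bind (by fun_prop) hf.aemeasurable]
  rw [hmk] at c₁ c₂ ⊢
  refine lintegral_congr_ae ?_
  filter_upwards [c₁, c₂] with u h1 h2
  rw [Kernel.lintegral_id_prod hf]
  rw [Kernel.prod_apply, h1, h2, lintegral_prod _ (by fun_prop)]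
  rw [l₁ u _ (by fun_prop)]
  refine lintegral_congr fun z => ?_
  rw [l₂ u _ (by fun_prop)]

lemma expNeg_two_mul (R : ℝ≥0∞) : expNeg (2 * R) = expNeg R ^ 2 := by
  unfold expNeg
  by_cases h : R = ⊤
  · simp [h]
  · rw [if_neg h, if_neg (ENNReal.mul_ne_top (by simp) h), ← Real.exp_nat_mul]
    simp

lemma expNeg_nonneg (R : ℝ≥0∞) : 0 ≤ expNeg R := by
  unfold expNeg; split_ifs <;> positivity

lemma expNeg_le_one (R : ℝ≥0∞) : expNeg R ≤ 1 := by
  unfold expNeg; split_ifs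
  · norm_num
  · simp

/-- correlation coefficient at rate `R`. -/
noncomputable def corr (R : ℝ≥0∞) : ℝ := Real.sqrt (1 - expNeg (2 * R))

lemma one_sub_nonneg (R : ℝ≥0∞) : 0 ≤ 1 - expNeg (2 * R) := sub_nonneg.2 (expNeg_le_one _)

lemma corr_sq (R : ℝ≥0∞) : corr R ^ 2 + expNeg R ^ 2 = 1 := by
  rw [corr, Real.sq_sqrt (one_sub_nonneg R), expNeg_two_mul]; ring

lemma corr_nonneg (R : ℝ≥0∞) : 0 ≤ corr R := Real.sqrt_nonneg _

lemma corr_le_one (R : ℝ≥0∞) : corr R ≤ 1 := by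
  nlinarith [corr_sq R, corr_nonneg R, sq_nonneg (expNeg R)]

lemma xi_eq (R Rc : ℝ≥0∞) : xiRRc R Rc = corr R * corr (R + Rc) := by
  rw [xiRRc, corr, corr, Real.sqrt_mul (one_sub_nonneg R)]

lemma MI_bound (m t : ℝ) (ht : 0 < t) (R : ℝ≥0∞) :
    KLD ((stdg.prod stdg).map (fun w => (m + t * (corr R * w.1 + expNeg R * w.2), w.1)))
      ((gauss m t).prod stdg) ≤ R := by
  by_cases h : R = ⊤
  · rw [h]; exact le_top
  · have hc : expNeg R = Real.exp (-R.toReal) := by rw [expNeg, if_neg h]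
    rw [KLD_joint m t _ _ ht (by rw [hc]; positivity) (corr_sq R), hc, Real.log_exp, neg_neg,
      ENNReal.ofReal_toReal h]

lemma psi_anti (σ s s' : ℝ) (hs : 0 < s) (hss : s ≤ s') (hσ : s' ≤ σ) : psi σ s' ≤ psi σ s := by
  unfold psi
  have hs' : 0 < s' := by linarith
  have hσ0 : 0 < σ := by linarith
  rw [Real.log_div hσ0.ne' hs.ne', Real.log_div hσ0.ne' hs'.ne']
  have h1 := Real.one_sub_inv_le_log_of_pos (div_pos hs' hs)
  rw [Real.log_div hs'.ne' hs.ne', inv_div] at h1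
  have h2 : (s' ^ 2 - σ ^ 2) / (2 * σ ^ 2) - (s ^ 2 - σ ^ 2) / (2 * σ ^ 2) ≤ 1 - s / s' := by
    have e : (s' ^ 2 - σ ^ 2) / (2 * σ ^ 2) - (s ^ 2 - σ ^ 2) / (2 * σ ^ 2) =
      (s' ^ 2 - s ^ 2) / (2 * σ ^ 2) := by ring
    have e2 : 1 - s / s' = (2 * s' * (s' - s)) / (2 * s' ^ 2) := by field_simp
    rw [e, e2]
    apply div_le_div₀
    · exact mul_nonneg (by positivity) (by linarith)
    · nlinarith
    · positivity
    · have := pow_le_pow_left₀ hs'.le hσ 2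
      linarith
  linarith

/-- Theorem 2 of Xie et al. (upper bound, KL perception measure). -/
theorem stmt1 (μX σX : ℝ) (hσX : 0 < σX) (R Rc : ℝ≥0∞) (P : ℝ) (hP : 0 ≤ P)
    (sP : ℝ) (hsP : sP ∈ Set.Icc 0 σX) (hψ : psi σX sP = P) :
    DRP (gauss μX σX) (fun p q => KLD q p) R Rc (ENNReal.ofReal P) ≤
      ENNReal.ofReal (σX ^ 2 - σX ^ 2 * xiRRc R Rc ^ 2 +
        max (sP - σX * xiRRc R Rc) 0 ^ 2) := by
  set a := corr R with ha
  set c := expNeg R with hc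
  set b := corr (R + Rc) with hb
  set d := expNeg (R + Rc) with hd
  have hac : a ^ 2 + c ^ 2 = 1 := corr_sq R
  have hbd : b ^ 2 + d ^ 2 = 1 := corr_sq (R + Rc)
  have hsP0 : 0 < sP := by
    rcases hsP.1.lt_or_eq with h | h
    · exact h
    · exfalso
      rw [← h] at hψ
      unfold psi at hψ
      have : (0 ^ 2 - σX ^ 2) / (2 * σX ^ 2) = -(1 / 2) := by field_simp; ring
      rw [this] at hψ
      simp at hψ
      linarith
  rw [xi_eq, ← ha, ← hb]
  have hab : a * b ≤ 1 := mul_le_one₀ (corr_le_one _) (corr_nonneg _) (corr_le_one _)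
  set s := max sP (σX * (a * b)) with hs
  have hs0 : 0 < s := lt_of_lt_of_le hsP0 (le_max_left _ _)
  have hsσ : s ≤ σX := max_le hsP.2 (by nlinarith)
  set ν : Measure (ℝ × ℝ × ℝ) := stdg.prod (stdg.prod stdg) with hν
  let T : ℝ × ℝ × ℝ → ℝ × ℝ × ℝ := fun w =>
    (μX + σX * (a * w.1 + c * w.2.1), w.1, μX + s * (b * w.1 + d * w.2.2))
  have hT : Measurable T := by fun_prop
  have hprob : IsProbabilityMeasure (ν.map T) := Measure.isProbabilityMeasure_map hT.aemeasurable
  have p1 : ν.map (fun w => (w.1, w.2.1)) = stdg.prod stdg := by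
    have := Measure.map_prod_map stdg (stdg.prod stdg) measurable_id (measurable_fst (α := ℝ) (β := ℝ))
    rw [Measure.map_id, Measure.map_fst_prod] at this
    simp only [measure_univ, one_smul] at this
    exact this.symm
  have p2 : ν.map (fun w => (w.1, w.2.2)) = stdg.prod stdg := by
    have := Measure.map_prod_map stdg (stdg.prod stdg) measurable_id (measurable_snd (α := ℝ) (β := ℝ))
    rw [Measure.map_id, Measure.map_snd_prod] at this
    simp only [measure_univ, one_smul] at this
    exact this.symm
  have mX : (ν.map T).map (fun w => w.1) = gauss μX σX := by
    rw [← stdg_prod_map μX σX a c hac, ← p1, Measure.map_map (by fun_prop) hT,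
      Measure.map_map (by fun_prop) (by fun_prop)]
    rfl
  have mY : (ν.map T).map (fun w => w.2.2) = gauss μX s := by
    rw [← stdg_prod_map μX s b d hbd, ← p2, Measure.map_map (by fun_prop) hT,
      Measure.map_map (by fun_prop) (by fun_prop)]
    rfl
  have mU : (ν.map T).map (fun w => w.2.1) = stdg := by
    rw [Measure.map_map (by fun_prop) hT]
    have : ν.map (fun w => w.1) = stdg := by
      have := Measure.map_fst_prod (μ := stdg) (ν := stdg.prod stdg)
      simp only [measure_univ, one_smul] at this
      exact this
    exact this
  have mXU : (ν.map T).map (fun w => (w.1, w.2.1)) =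
      (stdg.prod stdg).map (fun w => (μX + σX * (a * w.1 + c * w.2), w.1)) := by
    rw [← p1, Measure.map_map (by fun_prop) hT, Measure.map_map (by fun_prop) (by fun_prop)]
    rfl
  have mYU : (ν.map T).map (fun w => (w.2.2, w.2.1)) =
      (stdg.prod stdg).map (fun w => (μX + s * (b * w.1 + d * w.2), w.1)) := by
    rw [← p2, Measure.map_map (by fun_prop) hT, Measure.map_map (by fun_prop) (by fun_prop)]
    rfl
  have hfeas : DRPfeasible (gauss μX σX) (fun p q => KLD q p) R Rc (ENNReal.ofReal P) (ν.map T) := by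
    refine ⟨hprob, mX, ?_, ?_, ?_, ?_⟩
    · exact condIndep_aux (fun u z => μX + σX * (a * u + c * z)) (fun u z => μX + s * (b * u + d * z))
        (by unfold Function.uncurry; fun_prop) (by unfold Function.uncurry; fun_prop) (ν.map T) rfl
    · unfold mutInfo
      rw [mX, mU, mXU]
      exact MI_bound μX σX hσX R
    · unfold mutInfo
      rw [mY, mU, mYU]
      exact MI_bound μX s hs0 (R + Rc)
    · simp only
      rw [mY, KLD_gauss _ _ _ hs0 hσX]
      refine ENNReal.ofReal_le_ofReal ?_
      rw [← hψ]
      exact psi_anti σX sP s hsP0 (le_max_left _ _) hsσ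
  refine (iInf₂_le (ν.map T) hfeas).trans ?_
  unfold distortion
  rw [lintegral_map (by fun_prop) hT]
  have e : ∀ w : ℝ × ℝ × ℝ, ((T w).1 - (T w).2.2) ^ 2 =
      ((σX * a - s * b) * w.1 + (σX * c) * w.2.1 + (-(s * d)) * w.2.2) ^ 2 := by
    intro w; simp only [T]; ring
  simp_rw [e]
  rw [hν, stdg_lint3]
  refine ENNReal.ofReal_le_ofReal (le_of_eq ?_)
  have hm : max (sP - σX * (a * b)) 0 = s - σX * (a * b) := by
    rw [hs, ← max_sub_sub_right, sub_self]
  rw [hm]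
  linear_combination σX ^ 2 * hac + s ^ 2 * hbd
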